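/- The even lattices U ⊕ U(3) and E₆ ⊕ A₂ (negative definite) have isomorphic discriminant lattices: there is a group isomorphism of their discriminant groups (both isomorphic to (ℤ/3ℤ)²) that commutes with the discriminant forms q with values in ℚ/2ℤ. -/

import Mathlib

namespace Paper

/-- The `ℚ`-bilinear form on `ι → ℚ` with Gram matrix `M`. -/
def Bq {ι : Type*} [Fintype ι] (M : Matrix ι ι ℚ) (x y : ι → ℚ) : ℚ :=
  ∑ i, ∑ j, x i * M i j * y j

/-- The standard copy of the lattice `L = ℤ^ι` inside `L ⊗ ℚ = ℚ^ι`, as a `ℤ`-submodule. -/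
def intLat (ι : Type*) [Fintype ι] [DecidableEq ι] : Submodule ℤ (ι → ℚ) :=
  Submodule.span ℤ (Set.range fun i : ι => Pi.single i (1 : ℚ))

/-- The dual lattice `L^∨ = {x ∈ L ⊗ ℚ : ⟨x,l⟩ ∈ ℤ for all l ∈ L}` of the lattice with
Gram matrix `M`. -/
def dualLat {ι : Type*} [Fintype ι] [DecidableEq ι] (M : Matrix ι ι ℚ) :
    Submodule ℤ (ι → ℚ) where
  carrier := {x | ∀ l ∈ intLat ι, ∃ k : ℤ, Bq M x l = k}
  add_mem' := by
    intro a b ha hb l hl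
    obtain ⟨k₁, h₁⟩ := ha l hl
    obtain ⟨k₂, h₂⟩ := hb l hl
    refine ⟨k₁ + k₂, ?_⟩
    have h : Bq M (a + b) l = Bq M a l + Bq M b l := by
      simp [Bq, add_mul, Finset.sum_add_distrib]
    rw [h, h₁, h₂]; push_cast; ring
  zero_mem' := by
    intro l hl
    exact ⟨0, by simp [Bq]⟩
  smul_mem' := by
    intro c a ha l hl
    obtain ⟨k, h⟩ := ha l hl
    refine ⟨c * k, ?_⟩
    have hs : Bq M (c • a) l = (c : ℚ) * Bq M a l := by
      simp [Bq, Finset.mul_sum, mul_assoc]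
    rw [hs, h]; push_cast; ring

/-- The discriminant group `G_L = L^∨/L` of the lattice with Gram matrix `M`. -/
abbrev discGroup {ι : Type*} [Fintype ι] [DecidableEq ι] (M : Matrix ι ι ℚ) :=
  ↥(dualLat M) ⧸ (intLat ι).comap (dualLat M).subtype

/-- The class in the discriminant group `G_L = L^∨/L` of an element of `L^∨`. -/
def discMk {ι : Type*} [Fintype ι] [DecidableEq ι] (M : Matrix ι ι ℚ)
    (x : ↥(dualLat M)) : discGroup M :=
  Submodule.Quotient.mk x
/-- The Gram matrix (over `ℚ`) of the negative definite root lattice `E_n` (`n = 6,7,8`):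
basis `e₁, …, e_n` (`0`-based indices here), `⟨eᵢ,eᵢ⟩ = -2`, `⟨eᵢ,eⱼ⟩ = 1` exactly when
`{i,j}` is an edge of the Dynkin diagram given by the chain `e₂–e₃–⋯–e_n` together with
`e₁` joined to `e₄`, and `0` otherwise. -/
def EMatQ (n : ℕ) : Matrix (Fin n) (Fin n) ℚ := fun i j =>
  if i = j then -2
  else if (1 ≤ (i : ℕ) ∧ (i : ℕ) + 1 = (j : ℕ)) ∨ (1 ≤ (j : ℕ) ∧ (j : ℕ) + 1 = (i : ℕ))
      ∨ ((i : ℕ) = 0 ∧ (j : ℕ) = 3) ∨ ((i : ℕ) = 3 ∧ (j : ℕ) = 0) then 1 else 0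

/-- The Gram matrix of the even lattice `U ⊕ U(3)`, in the basis `u₁, u₂, u′₁, u′₂`. -/
def UU3Mat : Matrix (Fin 4) (Fin 4) ℚ := !![0, 1, 0, 0; 1, 0, 0, 0; 0, 0, 0, 3; 0, 0, 3, 0]

/-- The Gram matrix of the negative definite root lattice `A₂`. -/
def A2MatQ : Matrix (Fin 2) (Fin 2) ℚ := !![-2, 1; 1, -2]

/-- The Gram matrix of the orthogonal direct sum `E₆ ⊕ A₂` (negative definite). -/
def E6A2Mat : Matrix (Fin 6 ⊕ Fin 2) (Fin 6 ⊕ Fin 2) ℚ :=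
  Matrix.fromBlocks (EMatQ 6) 0 0 A2MatQ

theorem mem_intLat_iff {ι : Type*} [Fintype ι] [DecidableEq ι] {x : ι → ℚ} :
    x ∈ intLat ι ↔ ∀ i, ∃ k : ℤ, x i = k := by
  have h : (Set.range fun i : ι => Pi.single i (1 : ℚ)) = Set.range (Pi.basisFun ℚ ι) := by
    congr 1
    ext1 i
    simp
  rw [intLat, h, Module.Basis.mem_span_iff_repr_mem]
  simp [eq_comm]

theorem mem_dualLat_iff {ι : Type*} [Fintype ι] [DecidableEq ι] {M : Matrix ι ι ℚ} {x : ι → ℚ} :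
    x ∈ dualLat M ↔ ∀ j, ∃ k : ℤ, ∑ i, x i * M i j = k := by
  have hsingle (j : ι) : Bq M x (Pi.single j 1) = ∑ i, x i * M i j := by
    simp [Bq, Pi.single_apply]
  constructor
  · intro hx j
    rw [← hsingle]
    exact hx _ (Submodule.subset_span ⟨j, rfl⟩)
  · intro hx l hl
    choose k hk using hx
    choose c hc using mem_intLat_iff.1 hl
    refine ⟨∑ j, k j * c j, ?_⟩
    push_cast
    simp_rw [← hk, ← hc, Finset.sum_mul]
    exact Finset.sum_comm

/-- Two integer-valued functionals on the dual lattice which, modulo 3, are jointly surjective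
with common kernel `L`, identify the discriminant group with `(ℤ/3ℤ)²`. -/
theorem exists_discGroup_addEquiv {ι : Type*} [Fintype ι] [DecidableEq ι] (M : Matrix ι ι ℚ)
    (ψ₁ ψ₂ : (ι → ℚ) →+ ℚ)
    (hint : ∀ x ∈ dualLat M, ∃ s t : ℤ, ψ₁ x = s ∧ ψ₂ x = t)
    (hker : ∀ x ∈ dualLat M, x ∈ intLat ι ↔ ∃ a b : ℤ, ψ₁ x = 3 * a ∧ ψ₂ x = 3 * b)
    (hsurj : ∀ s t : ℤ, ∃ x ∈ dualLat M, ∃ a b : ℤ, ψ₁ x = s + 3 * a ∧ ψ₂ x = t + 3 * b) :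
    ∃ e : discGroup M ≃+ ZMod 3 × ZMod 3, ∀ (x : ↥(dualLat M)) (s t : ℤ),
      ψ₁ x.1 = s → ψ₂ x.1 = t → e (discMk M x) = ((s : ZMod 3), (t : ZMod 3)) := by
  choose s t hs ht using fun x : ↥(dualLat M) => hint x.1 x.2
  let φ : ↥(dualLat M) →+ ZMod 3 × ZMod 3 :=
    AddMonoidHom.mk' (fun x => ((s x : ZMod 3), (t x : ZMod 3))) fun x y => by
      have h₁ : s (x + y) = s x + s y := by
        have := map_add ψ₁ x.1 y.1
        rw [hs, hs] at this
        exact_mod_cast (hs (x + y)).symm.trans this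
      have h₂ : t (x + y) = t x + t y := by
        have := map_add ψ₂ x.1 y.1
        rw [ht, ht] at this
        exact_mod_cast (ht (x + y)).symm.trans this
      simp [h₁, h₂]
  have hφ (x) (u v : ℤ) (hu : ψ₁ x.1 = u) (hv : ψ₂ x.1 = v) :
      φ x = ((u : ZMod 3), (v : ZMod 3)) := by
    rw [hs] at hu
    rw [ht] at hv
    norm_cast at hu hv
    subst hu hv
    rfl
  have hsurjφ : Function.Surjective φ.toIntLinearMap := by
    rintro ⟨p, q⟩
    obtain ⟨u, rfl⟩ := ZMod.intCast_surjective p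
    obtain ⟨v, rfl⟩ := ZMod.intCast_surjective q
    obtain ⟨x, hx, a, b, ha, hb⟩ := hsurj u v
    refine ⟨⟨x, hx⟩, (hφ ⟨x, hx⟩ (u + 3 * a) (v + 3 * b) ?_ ?_).trans ?_⟩
    · simpa using ha
    · simpa using hb
    · have h3 : (3 : ZMod 3) = 0 := rfl
      simp [h3]
  have hkerφ : (intLat ι).comap (dualLat M).subtype = LinearMap.ker φ.toIntLinearMap := by
    ext x
    rw [Submodule.mem_comap, Submodule.subtype_apply, hker x.1 x.2, LinearMap.mem_ker]
    change _ ↔ ((s x : ZMod 3), (t x : ZMod 3)) = 0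
    rw [Prod.mk_eq_zero, ZMod.intCast_zmod_eq_zero_iff_dvd, ZMod.intCast_zmod_eq_zero_iff_dvd,
      hs, ht]
    norm_cast
    simp [dvd_def]
  exact ⟨((Submodule.quotEquivOfEq _ _ hkerφ).trans
    (φ.toIntLinearMap.quotKerEquivOfSurjective hsurjφ)).toAddEquiv, hφ⟩

theorem mem_dualLat_UU3Mat_iff {x : Fin 4 → ℚ} :
    x ∈ dualLat UU3Mat ↔ ∃ m n a b : ℤ, x 0 = m ∧ x 1 = n ∧ 3 * x 2 = a ∧ 3 * x 3 = b := by
  simp only [mem_dualLat_iff, Fin.forall_fin_succ, Fin.sum_univ_succ, UU3Mat]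
  simp [mul_comm]
  grind

theorem EMatQ_six : EMatQ 6 = !![-2, 0, 0, 1, 0, 0; 0, -2, 1, 0, 0, 0; 0, 1, -2, 1, 0, 0;
    1, 0, 1, -2, 1, 0; 0, 0, 0, 1, -2, 1; 0, 0, 0, 0, 1, -2] := by
  ext i j
  fin_cases i <;> fin_cases j <;> simp [EMatQ]

theorem mem_dualLat_E6A2Mat_iff {x : Fin 6 ⊕ Fin 2 → ℚ} :
    x ∈ dualLat E6A2Mat ↔ ∃ s t l₀ l₂ l₃ l₄ l₅ n : ℤ,
      3 * x (.inl 1) = s ∧ 3 * x (.inr 0) = t ∧ x (.inl 0) = l₀ ∧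
      x (.inl 2) = 2 * x (.inl 1) + l₂ ∧ x (.inl 3) = l₃ ∧ x (.inl 4) = x (.inl 1) + l₄ ∧
      x (.inl 5) = 2 * x (.inl 1) + l₅ ∧ x (.inr 1) = 2 * x (.inr 0) + n := by
  rw [mem_dualLat_iff]
  simp only [Sum.forall, Fin.forall_fin_succ, Fintype.sum_sum_type, Fin.sum_univ_succ, E6A2Mat,
    EMatQ_six, A2MatQ]
  constructor
  · intro h
    simp at h
    obtain ⟨⟨⟨k₀, h₀⟩, ⟨k₁, h₁⟩, ⟨k₂, h₂⟩, ⟨k₃, h₃⟩, ⟨k₄, h₄⟩, ⟨k₅, h₅⟩⟩, ⟨j₀, g₀⟩, ⟨j₁, g₁⟩⟩ := h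
    refine ⟨-(3 * k₀ + 4 * k₁ + 5 * k₂ + 6 * k₃ + 4 * k₄ + 2 * k₅), -(2 * j₀ + j₁),
      -(2 * k₀ + k₁ + 2 * k₂ + 3 * k₃ + 2 * k₄ + k₅), k₁,
      -(3 * k₀ + 2 * k₁ + 4 * k₂ + 6 * k₃ + 4 * k₄ + 2 * k₅),
      -(k₀ + k₂ + 2 * k₃ + 2 * k₄ + k₅), k₀ + 2 * k₁ + 2 * k₂ + 2 * k₃ + k₄, j₀, ?_⟩
    push_cast
    refine ⟨?_, ?_, ?_, ?_, ?_, ?_, ?_, ?_⟩ <;> linarith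
  · rintro ⟨s, t, l₀, l₂, l₃, l₄, l₅, n, hs, ht, h₀, h₂, h₃, h₄, h₅, hn⟩
    simp
    refine ⟨⟨⟨-2 * l₀ + l₃, ?_⟩, ⟨l₂, ?_⟩, ⟨-s - 2 * l₂ + l₃, ?_⟩,
      ⟨s + l₀ + l₂ - 2 * l₃ + l₄, ?_⟩, ⟨l₃ - 2 * l₄ + l₅, ?_⟩, ⟨-s + l₄ - 2 * l₅, ?_⟩⟩,
      ⟨n, ?_⟩, ⟨-t - 2 * n, ?_⟩⟩ <;> push_cast <;> linarith

theorem Bq_UU3Mat_self (x : Fin 4 → ℚ) : Bq UU3Mat x x = 2 * (x 0 * x 1 + 3 * x 2 * x 3) := by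
  simp [Bq, Fin.sum_univ_succ, UU3Mat]
  ring

theorem Bq_E6A2Mat_self (x : Fin 6 ⊕ Fin 2 → ℚ) :
    Bq E6A2Mat x x = 2 * (x (.inl 0) * x (.inl 3) + x (.inl 1) * x (.inl 2)
      + x (.inl 2) * x (.inl 3) + x (.inl 3) * x (.inl 4) + x (.inl 4) * x (.inl 5)
      - x (.inl 0) ^ 2 - x (.inl 1) ^ 2 - x (.inl 2) ^ 2 - x (.inl 3) ^ 2 - x (.inl 4) ^ 2
      - x (.inl 5) ^ 2 + (x (.inr 0) * x (.inr 1) - x (.inr 0) ^ 2 - x (.inr 1) ^ 2)) := by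
  simp only [Bq, Fintype.sum_sum_type, Fin.sum_univ_succ, E6A2Mat, EMatQ_six, A2MatQ]
  simp
  ring

theorem exists_discGroup_UU3Mat_addEquiv :
    ∃ e : discGroup UU3Mat ≃+ ZMod 3 × ZMod 3, ∀ x : ↥(dualLat UU3Mat), ∃ s t m : ℤ,
      e (discMk UU3Mat x) = ((s : ZMod 3), (t : ZMod 3)) ∧
        Bq UU3Mat x.1 x.1 = 2 / 3 * (s ^ 2 - t ^ 2) + 2 * m := by
  let p (i : Fin 4) : (Fin 4 → ℚ) →+ ℚ := Pi.evalAddMonoidHom _ i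
  obtain ⟨e, he⟩ := exists_discGroup_addEquiv UU3Mat (3 • (p 2 + p 3)) (3 • (p 2 - p 3))
    (by
      intro x hx
      obtain ⟨m, n, a, b, hm, hn, ha, hb⟩ := mem_dualLat_UU3Mat_iff.1 hx
      refine ⟨a + b, a - b, ?_, ?_⟩ <;> simp [p] <;> linarith)
    (by
      intro x hx
      obtain ⟨m, n, a, b, hm, hn, ha, hb⟩ := mem_dualLat_UU3Mat_iff.1 hx
      simp only [mem_intLat_iff, Fin.forall_fin_succ]
      simp [p]
      constructor
      · rintro ⟨-, -, ⟨k, hk⟩, ⟨l, hl⟩⟩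
        exact ⟨⟨k + l, by push_cast; linarith⟩, ⟨k - l, by push_cast; linarith⟩⟩
      · rintro ⟨⟨k, hk⟩, ⟨l, hl⟩⟩
        refine ⟨⟨m, hm⟩, ⟨n, hn⟩, ⟨2 * k + 2 * l - a, ?_⟩, ⟨2 * k - 2 * l - b, ?_⟩⟩ <;>
          push_cast <;> linarith)
    (by
      intro s t
      refine ⟨![0, 0, 2 / 3 * (s + t), 2 / 3 * (s - t)], mem_dualLat_UU3Mat_iff.2
        ⟨0, 0, 2 * (s + t), 2 * (s - t), ?_⟩, s, t, ?_⟩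
      · refine ⟨?_, ?_, ?_, ?_⟩ <;> simp <;> ring
      · constructor <;> simp [p] <;> ring)
  refine ⟨e, fun x => ?_⟩
  obtain ⟨m, n, a, b, hm, hn, ha, hb⟩ := mem_dualLat_UU3Mat_iff.1 x.2
  refine ⟨a + b, a - b, m * n - a * b, he x _ _ ?_ ?_, ?_⟩
  · simp [p]; linarith
  · simp [p]; linarith
  · rw [Bq_UU3Mat_self]
    push_cast
    rw [← hm, ← hn, ← ha, ← hb]
    ring

theorem exists_discGroup_E6A2Mat_addEquiv :
    ∃ e : discGroup E6A2Mat ≃+ ZMod 3 × ZMod 3, ∀ x : ↥(dualLat E6A2Mat), ∃ s t m : ℤ,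
      e (discMk E6A2Mat x) = ((s : ZMod 3), (t : ZMod 3)) ∧
        Bq E6A2Mat x.1 x.1 = 2 / 3 * (s ^ 2 - t ^ 2) + 2 * m := by
  let p (i : Fin 6 ⊕ Fin 2) : (Fin 6 ⊕ Fin 2 → ℚ) →+ ℚ := Pi.evalAddMonoidHom _ i
  obtain ⟨e, he⟩ := exists_discGroup_addEquiv E6A2Mat (3 • p (.inl 1)) (3 • p (.inr 0))
    (by
      intro x hx
      obtain ⟨s, t, -, -, -, -, -, -, hs, ht, -⟩ := mem_dualLat_E6A2Mat_iff.1 hx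
      exact ⟨s, t, by simpa [p] using hs, by simpa [p] using ht⟩)
    (by
      intro x hx
      obtain ⟨s, t, l₀, l₂, l₃, l₄, l₅, n, hs, ht, h₀, h₂, h₃, h₄, h₅, hn⟩ :=
        mem_dualLat_E6A2Mat_iff.1 hx
      simp only [mem_intLat_iff, Sum.forall, Fin.forall_fin_succ]
      simp [p]
      constructor
      · rintro ⟨⟨-, h, -⟩, h', -⟩
        exact ⟨h, h'⟩
      · rintro ⟨⟨k, hk⟩, ⟨l, hl⟩⟩
        refine ⟨⟨⟨l₀, h₀⟩, ⟨k, hk⟩, ⟨2 * k + l₂, ?_⟩, ⟨l₃, h₃⟩, ⟨k + l₄, ?_⟩,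
          ⟨2 * k + l₅, ?_⟩⟩, ⟨l, hl⟩, ⟨2 * l + n, ?_⟩⟩ <;> push_cast <;> linarith)
    (by
      intro s t
      refine ⟨Sum.elim ![0, s / 3, 2 * (s / 3), 0, s / 3, 2 * (s / 3)] ![t / 3, 2 * (t / 3)],
        mem_dualLat_E6A2Mat_iff.2 ⟨s, t, 0, 0, 0, 0, 0, 0, ?_⟩, 0, 0, ?_⟩
      · simp
        constructor <;> ring
      · simp [p]
        constructor <;> ring)
  refine ⟨e, fun x => ?_⟩
  obtain ⟨s, t, l₀, l₂, l₃, l₄, l₅, n, hs, ht, h₀, h₂, h₃, h₄, h₅, hn⟩ :=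
    mem_dualLat_E6A2Mat_iff.1 x.2
  refine ⟨s, t, -s ^ 2 - s * l₂ - s * l₅ + s * l₃ - l₀ ^ 2 - l₂ ^ 2 - l₃ ^ 2 - l₄ ^ 2 - l₅ ^ 2
    + l₀ * l₃ + l₂ * l₃ + l₃ * l₄ + l₄ * l₅ - t * n - n ^ 2, he x _ _ ?_ ?_, ?_⟩
  · simpa [p] using hs
  · simpa [p] using ht
  · rw [Bq_E6A2Mat_self, h₀, h₂, h₃, h₄, h₅, hn]
    push_cast
    rw [← hs, ← ht]
    ring

/-- The even lattices `U ⊕ U(3)` and `E₆ ⊕ A₂` have isomorphic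
discriminant lattices: their discriminant groups are both isomorphic to `(ℤ/3ℤ)²` and
there is a group isomorphism between them commuting with the discriminant forms (for
representatives `x, y` of corresponding classes, `⟨y,y⟩ ≡ ⟨x,x⟩ mod 2ℤ`). -/
theorem statement8 :
    Nonempty (discGroup UU3Mat ≃+ ZMod 3 × ZMod 3) ∧
    Nonempty (discGroup E6A2Mat ≃+ ZMod 3 × ZMod 3) ∧
    ∃ f : discGroup UU3Mat ≃+ discGroup E6A2Mat,
      ∀ (x : ↥(dualLat UU3Mat)) (y : ↥(dualLat E6A2Mat)),
        f (discMk UU3Mat x) = discMk E6A2Mat y →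
        ∃ m : ℤ, Bq E6A2Mat y.1 y.1 - Bq UU3Mat x.1 x.1 = 2 * m := by
  obtain ⟨e₁, h₁⟩ := exists_discGroup_UU3Mat_addEquiv
  obtain ⟨e₂, h₂⟩ := exists_discGroup_E6A2Mat_addEquiv
  refine ⟨⟨e₁⟩, ⟨e₂⟩, e₁.trans e₂.symm, fun x y hxy => ?_⟩
  obtain ⟨s, t, m, hx, hBx⟩ := h₁ x
  obtain ⟨s', t', m', hy, hBy⟩ := h₂ y
  rw [AddEquiv.trans_apply, AddEquiv.symm_apply_eq, hx, hy, Prod.mk.injEq,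
    ZMod.intCast_eq_intCast_iff_dvd_sub, ZMod.intCast_eq_intCast_iff_dvd_sub] at hxy
  obtain ⟨⟨k, hk⟩, ⟨l, hl⟩⟩ := hxy
  obtain rfl : s' = s + 3 * k := by push_cast at hk; linarith
  obtain rfl : t' = t + 3 * l := by push_cast at hl; linarith
  refine ⟨2 * s * k + 3 * k ^ 2 - 2 * t * l - 3 * l ^ 2 + m' - m, ?_⟩
  rw [hBx, hBy]
  push_cast
  ring

end Paper
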